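/- arXiv:1707.01365 — 3 statements merged into one kernel-verified Lean document; each statement's English description precedes it below -/
import Mathlib

section
/- In the latent-variable model with kernels K_i satisfying ν_i ≤ K_i ≤ 1, for any two priors π_V, π'_V and any 1 ≤ q ≤ n: |log P_{π_V}(X_q | X_{q+1:n}) − log P_{π'_V}(X_q | X_{q+1:n})| ≤ 2·Σ_{ℓ=0}^{n+1−q} (ν_q ν_{q+ℓ−1} ν_{q+ℓ})^{-1} · (∏_{k=q+1}^{q+ℓ−1}(1−ν_k)) · ‖π_V − π'_V‖_tv. -/
open MeasureTheory

/-- `betaAux π K x m i v` : conditional probability of observing `x i, …, x (i+m-1)`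
given that the latent variable with index `i` equals `v`, in the model where the
latent variables are i.i.d. with law `π` and `P(X_i = y | V) = K i y V_i V_{i+1}`. -/
noncomputable def betaAux {V 𝕏 : Type*} [MeasurableSpace V] (π : Measure V)
    (K : ℕ → 𝕏 → V → V → ℝ) (x : ℕ → 𝕏) : ℕ → ℕ → V → ℝ
  | 0, _, _ => 1
  | m + 1, i, v => ∫ w, K i (x i) v w * betaAux π K x m (i + 1) w ∂π

/-- Marginal likelihood `P(X_q = x_q, …, X_n = x_n)`. -/
noncomputable def margP {V 𝕏 : Type*} [MeasurableSpace V] (π : Measure V)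
    (K : ℕ → 𝕏 → V → V → ℝ) (x : ℕ → 𝕏) (q n : ℕ) : ℝ :=
  ∫ v, betaAux π K x (n + 1 - q) q v ∂π

/-- Conditional probability `P(X_q = x_q | X_{q+1:n} = x_{q+1:n})`. -/
noncomputable def condP {V 𝕏 : Type*} [MeasurableSpace V] (π : Measure V)
    (K : ℕ → 𝕏 → V → V → ℝ) (x : ℕ → 𝕏) (q n : ℕ) : ℝ :=
  margP π K x q n / margP π K x (q + 1) n

/-- Total variation distance between two measures. -/
noncomputable def tvDist {Z : Type*} [MeasurableSpace Z] (μ ν : Measure Z) : ℝ :=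
  ⨆ s : {s : Set Z // MeasurableSet s}, |(μ s.1).toReal - (ν s.1).toReal|

lemma tvDist_bddAbove {Z : Type*} [MeasurableSpace Z] (μ ν : Measure Z)
    [IsProbabilityMeasure μ] [IsProbabilityMeasure ν] :
    BddAbove (Set.range fun s : {s : Set Z // MeasurableSet s} =>
      |(μ s.1).toReal - (ν s.1).toReal|) := by
  refine ⟨1, ?_⟩
  rintro _ ⟨s, rfl⟩
  have h1 : μ.real s.1 ≤ 1 := measureReal_le_one
  have h2 : ν.real s.1 ≤ 1 := measureReal_le_one
  have h3 : 0 ≤ μ.real s.1 := measureReal_nonneg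
  have h4 : 0 ≤ ν.real s.1 := measureReal_nonneg
  simp only [measureReal_def] at h1 h2 h3 h4
  exact abs_le.2 ⟨by linarith, by linarith⟩

lemma abs_measureReal_sub_le_tvDist {Z : Type*} [MeasurableSpace Z] (μ ν : Measure Z)
    [IsProbabilityMeasure μ] [IsProbabilityMeasure ν] {s : Set Z} (hs : MeasurableSet s) :
    |μ.real s - ν.real s| ≤ tvDist μ ν :=
  le_ciSup (tvDist_bddAbove μ ν) ⟨s, hs⟩

lemma tvDist_nonneg {Z : Type*} [MeasurableSpace Z] (μ ν : Measure Z) : 0 ≤ tvDist μ ν :=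
  Real.iSup_nonneg fun _ => abs_nonneg _

lemma integrable_of_measurable_of_mem_Icc {Z : Type*} [MeasurableSpace Z] {μ : Measure Z}
    [IsFiniteMeasure μ] {f : Z → ℝ} (hf : Measurable f) {a b : ℝ}
    (h : ∀ z, a ≤ f z ∧ f z ≤ b) : Integrable f μ :=
  Integrable.of_mem_Icc a b hf.aemeasurable (.of_forall fun z => ⟨(h z).1, (h z).2⟩)

/-- Integrals of a function with values in `[0, C]` differ by at most `C` times the total
variation distance. -/
lemma abs_integral_sub_le_of_nonneg {Z : Type*} [MeasurableSpace Z] (μ ν : Measure Z)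
    [IsProbabilityMeasure μ] [IsProbabilityMeasure ν] {f : Z → ℝ} (hf : Measurable f) {C : ℝ}
    (hC : 0 ≤ C) (h : ∀ z, 0 ≤ f z ∧ f z ≤ C) :
    |∫ z, f z ∂μ - ∫ z, f z ∂ν| ≤ C * tvDist μ ν := by
  have layer (ρ : Measure Z) [IsProbabilityMeasure ρ] :
      ∫ z, f z ∂ρ = ∫ t in Set.Ioc 0 C, ρ.real {z | t ≤ f z} :=
    (integrable_of_measurable_of_mem_Icc hf h).integral_eq_integral_Ioc_meas_le
      (.of_forall fun z => (h z).1) (.of_forall fun z => (h z).2)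
  have integ (ρ : Measure Z) [IsProbabilityMeasure ρ] :
      IntegrableOn (fun t => ρ.real {z | t ≤ f z}) (Set.Ioc 0 C) := by
    have : Antitone fun t => ρ.real {z | t ≤ f z} := fun s t hst =>
      measureReal_mono fun z (hz : t ≤ f z) => hst.trans hz
    exact ((this.antitoneOn _).integrableOn_isCompact isCompact_Icc).mono_set
      Set.Ioc_subset_Icc_self
  rw [layer μ, layer ν, ← integral_sub (integ μ) (integ ν)]
  have := norm_setIntegral_le_of_norm_le_const (μ := volume) (s := Set.Ioc 0 C)
    (f := fun t => μ.real {z | t ≤ f z} - ν.real {z | t ≤ f z}) (C := tvDist μ ν)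
    (by simp) fun t _ => abs_measureReal_sub_le_tvDist μ ν (measurableSet_le measurable_const hf)
  simpa [hC, mul_comm] using this

lemma abs_integral_sub_le_of_abs_le {Z : Type*} [MeasurableSpace Z] (μ ν : Measure Z)
    [IsProbabilityMeasure μ] [IsProbabilityMeasure ν] {f : Z → ℝ} (hf : Measurable f) {M : ℝ}
    (hM : 0 ≤ M) (h : ∀ z, |f z| ≤ M) :
    |∫ z, f z ∂μ - ∫ z, f z ∂ν| ≤ 2 * M * tvDist μ ν := by
  have hi (ρ : Measure Z) [IsProbabilityMeasure ρ] : Integrable f ρ :=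
    integrable_of_measurable_of_mem_Icc hf fun z => abs_le.1 (h z)
  have := abs_integral_sub_le_of_nonneg μ ν (f := fun z => f z + M) (C := 2 * M)
    (hf.add_const M) (by positivity)
    fun z => ⟨by linarith [(abs_le.1 (h z)).1], by linarith [(abs_le.1 (h z)).2]⟩
  rw [integral_add (hi μ) (integrable_const _), integral_add (hi ν) (integrable_const _)] at this
  simpa using this

lemma Real.abs_log_sub_log_le {c x y : ℝ} (hc : 0 < c) (hx : c ≤ x) (hy : c ≤ y) :
    |Real.log x - Real.log y| ≤ |x - y| / c := by
  have key {a b : ℝ} (ha : c ≤ a) (hb : c ≤ b) : Real.log a - Real.log b ≤ |a - b| / c := by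
    have hb0 := hc.trans_le hb
    rw [← Real.log_div (hc.trans_le ha).ne' hb0.ne']
    calc Real.log (a / b) ≤ a / b - 1 :=
          Real.log_le_sub_one_of_pos (div_pos (hc.trans_le ha) hb0)
      _ = (a - b) / b := by field_simp
      _ ≤ |a - b| / b := by gcongr; exact le_abs_self _
      _ ≤ |a - b| / c := by gcongr
  rw [abs_le']
  refine ⟨key hx hy, ?_⟩
  rw [neg_sub, abs_sub_comm]
  exact key hy hx

lemma integral_mem_Icc_of_mem_Icc {Z : Type*} [MeasurableSpace Z] {μ : Measure Z}
    [IsProbabilityMeasure μ] {f : Z → ℝ} (hf : Measurable f) {a b : ℝ}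
    (h : ∀ z, a ≤ f z ∧ f z ≤ b) : a ≤ ∫ z, f z ∂μ ∧ ∫ z, f z ∂μ ≤ b := by
  have hi := integrable_of_measurable_of_mem_Icc (μ := μ) hf h
  constructor
  · simpa using integral_mono (μ := μ) (integrable_const a) hi fun z => (h z).1
  · simpa using integral_mono (μ := μ) hi (integrable_const b) fun z => (h z).2

lemma betaAux_measurable {V 𝕏 : Type*} [MeasurableSpace V] (π : Measure V)
    [IsProbabilityMeasure π] {K : ℕ → 𝕏 → V → V → ℝ}
    (hKmeas : ∀ i (y : 𝕏), Measurable fun p : V × V => K i y p.1 p.2)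
    (x : ℕ → 𝕏) (m i : ℕ) : Measurable (betaAux π K x m i) := by
  induction m generalizing i with
  | zero => exact measurable_const
  | succ m ih =>
    exact (StronglyMeasurable.integral_prod_right (ν := π)
      (f := fun v w => K i (x i) v w * betaAux π K x m (i + 1) w)
      ((hKmeas i (x i)).mul ((ih (i + 1)).comp measurable_snd)).stronglyMeasurable).measurable

/-- Integrating a `[c, 1]`-valued kernel against a positive function gives values within a factor
`c` of the total mass. -/
lemma integral_kernel_mul_bounds {V : Type*} [MeasurableSpace V] (π : Measure V)
    [IsProbabilityMeasure π] {k g : V → ℝ} (hk : Measurable k) (hg : Measurable g) {c a b : ℝ}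
    (hc : 0 ≤ c) (hkb : ∀ w, c ≤ k w ∧ k w ≤ 1) (ha : 0 ≤ a) (hgb : ∀ w, a ≤ g w ∧ g w ≤ b) :
    c * ∫ w, g w ∂π ≤ ∫ w, k w * g w ∂π ∧ ∫ w, k w * g w ∂π ≤ ∫ w, g w ∂π := by
  have hg0 w : 0 ≤ g w := ha.trans (hgb w).1
  have hi : Integrable g π := integrable_of_measurable_of_mem_Icc hg hgb
  have hki : Integrable (fun w => k w * g w) π :=
    integrable_of_measurable_of_mem_Icc (hk.mul hg) (a := 0) (b := b) fun w =>
      ⟨mul_nonneg (hc.trans (hkb w).1) (hg0 w),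
        (mul_le_of_le_one_left (hg0 w) (hkb w).2).trans (hgb w).2⟩
  constructor
  · rw [← integral_const_mul]
    exact integral_mono (hi.const_mul c) hki fun w =>
      mul_le_mul_of_nonneg_right (hkb w).1 (hg0 w)
  · exact integral_mono hki hi fun w => mul_le_of_le_one_left (hg0 w) (hkb w).2

lemma betaAux_bounds {V 𝕏 : Type*} [MeasurableSpace V] (π : Measure V)
    [IsProbabilityMeasure π] {K : ℕ → 𝕏 → V → V → ℝ} {ν : ℕ → ℝ}
    (hKmeas : ∀ i (y : 𝕏), Measurable fun p : V × V => K i y p.1 p.2)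
    (hν0 : ∀ i, 0 < ν i) (hν1 : ∀ i, ν i ≤ 1)
    (hKlb : ∀ i (y : 𝕏) (v w : V), ν i ≤ K i y v w)
    (hKub : ∀ i (y : 𝕏) (v w : V), K i y v w ≤ 1)
    (x : ℕ → 𝕏) (m i : ℕ) :
    ∃ G, 0 < G ∧ ∀ v, ν i * G ≤ betaAux π K x m i v ∧ betaAux π K x m i v ≤ G := by
  induction m generalizing i with
  | zero => exact ⟨1, one_pos, fun v => by simpa [betaAux] using hν1 i⟩
  | succ m ih =>
    obtain ⟨G, hG, hb⟩ := ih (i + 1)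
    have hm := betaAux_measurable π hKmeas x m (i + 1)
    have hpos := mul_pos (hν0 (i + 1)) hG
    refine ⟨∫ w, betaAux π K x m (i + 1) w ∂π,
      hpos.trans_le (integral_mem_Icc_of_mem_Icc hm hb).1, fun v => ?_⟩
    exact integral_kernel_mul_bounds π ((hKmeas i (x i)).comp measurable_prodMk_left) hm
      (hν0 i).le (fun w => ⟨hKlb i _ v w, hKub i _ v w⟩) hpos.le hb

/-- The ratio of the integrals of two proportional functions, as a function of the measure. -/
lemma abs_log_ratio_sub_le {V : Type*} [MeasurableSpace V] (π π' : Measure V)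
    [IsProbabilityMeasure π] [IsProbabilityMeasure π'] {A B g : V → ℝ}
    (hA : Measurable A) (hB : Measurable B) (hg : Measurable g) {lo₀ lo hi r b c G : ℝ}
    (hlo₀ : 0 < lo₀) (hlo' : lo₀ ≤ lo) (hr : 0 < r) (hb : 0 < b) (hc : 0 < c) (hG : 0 < G) (hlohi : lo ≤ hi)
    (hBb : ∀ v, r * b ≤ B v ∧ B v ≤ b) (hAB : ∀ v, lo * B v ≤ A v ∧ A v ≤ hi * B v)
    (hgb : ∀ v, c * G ≤ g v ∧ g v ≤ G) :
    |Real.log ((∫ v, A v * g v ∂π) / ∫ v, B v * g v ∂π)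
        - Real.log ((∫ v, A v * g v ∂π') / ∫ v, B v * g v ∂π')|
      ≤ 2 * tvDist π π' / lo₀ * ((hi - lo) * (r * c)⁻¹) := by
  have hlo := hlo₀.trans_le hlo'
  have hrb := mul_pos hr hb
  have hcG := mul_pos hc hG
  have hB0 v : 0 < B v := hrb.trans_le (hBb v).1
  have hg0 v : 0 < g v := hcG.trans_le (hgb v).1
  have hBg v : r * b * (c * G) ≤ B v * g v ∧ B v * g v ≤ b * G :=
    ⟨mul_le_mul (hBb v).1 (hgb v).1 hcG.le (hB0 v).le,
      mul_le_mul (hBb v).2 (hgb v).2 (hg0 v).le hb.le⟩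
  have hAg v : lo * (B v * g v) ≤ A v * g v ∧ A v * g v ≤ hi * (B v * g v) := by
    simp only [← mul_assoc]
    exact ⟨mul_le_mul_of_nonneg_right (hAB v).1 (hg0 v).le,
      mul_le_mul_of_nonneg_right (hAB v).2 (hg0 v).le⟩
  have hAg' v : 0 ≤ A v * g v ∧ A v * g v ≤ hi * (b * G) :=
    ⟨(by have := mul_pos (hB0 v) (hg0 v); positivity : 0 ≤ lo * (B v * g v)).trans (hAg v).1,
      (hAg v).2.trans (mul_le_mul_of_nonneg_left (hBg v).2 (hlo.le.trans hlohi))⟩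
  have iB (ρ : Measure V) [IsProbabilityMeasure ρ] : Integrable (fun v => B v * g v) ρ :=
    integrable_of_measurable_of_mem_Icc (hB.mul hg) hBg
  have iA (ρ : Measure V) [IsProbabilityMeasure ρ] : Integrable (fun v => A v * g v) ρ :=
    integrable_of_measurable_of_mem_Icc (hA.mul hg) hAg'
  have hD (ρ : Measure V) [IsProbabilityMeasure ρ] : r * b * (c * G) ≤ ∫ v, B v * g v ∂ρ :=
    (integral_mem_Icc_of_mem_Icc (hB.mul hg) hBg).1
  have hDpos (ρ : Measure V) [IsProbabilityMeasure ρ] : 0 < ∫ v, B v * g v ∂ρ :=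
    (mul_pos hrb hcG).trans_le (hD ρ)
  have hR (ρ : Measure V) [IsProbabilityMeasure ρ] :
      lo ≤ (∫ v, A v * g v ∂ρ) / (∫ v, B v * g v ∂ρ) ∧
        (∫ v, A v * g v ∂ρ) / (∫ v, B v * g v ∂ρ) ≤ hi := by
    rw [le_div_iff₀ (hDpos ρ), div_le_iff₀ (hDpos ρ), ← integral_const_mul, ← integral_const_mul]
    exact ⟨integral_mono ((iB ρ).const_mul _) (iA ρ) fun v => (hAg v).1,
      integral_mono (iA ρ) ((iB ρ).const_mul _) fun v => (hAg v).2⟩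
  set c₀ := (∫ v, A v * g v ∂π') / ∫ v, B v * g v ∂π' with hc₀
  have hf v : |A v * g v - c₀ * (B v * g v)| ≤ (hi - lo) * (b * G) := by
    have hpos := mul_pos (hB0 v) (hg0 v)
    have h1 : |A v * g v - c₀ * (B v * g v)| ≤ (hi - lo) * (B v * g v) := by
      have h2 := mul_le_mul_of_nonneg_right (hR π').1 hpos.le
      have h3 := mul_le_mul_of_nonneg_right (hR π').2 hpos.le
      have := hAg v
      rw [abs_le]; constructor <;> linarith
    exact h1.trans (mul_le_mul_of_nonneg_left (hBg v).2 (by linarith))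
  have hint (ρ : Measure V) [IsProbabilityMeasure ρ] :
      ∫ v, (A v * g v - c₀ * (B v * g v)) ∂ρ
        = ∫ v, A v * g v ∂ρ - c₀ * ∫ v, B v * g v ∂ρ := by
    rw [integral_sub (iA ρ) ((iB ρ).const_mul _), integral_const_mul]
  have htv := abs_integral_sub_le_of_abs_le π π'
    (f := fun v => A v * g v - c₀ * (B v * g v)) (by fun_prop)
    (M := (hi - lo) * (b * G)) (mul_nonneg (by linarith) (by positivity)) hf
  have hzero : ∫ v, A v * g v ∂π' - c₀ * ∫ v, B v * g v ∂π' = 0 := by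
    rw [hc₀, div_mul_cancel₀ _ (hDpos π').ne', sub_self]
  rw [hint, hint, hzero, sub_zero] at htv
  have hdiff : (∫ v, A v * g v ∂π) / (∫ v, B v * g v ∂π) - c₀
      = (∫ v, A v * g v ∂π - c₀ * ∫ v, B v * g v ∂π) / ∫ v, B v * g v ∂π := by
    rw [sub_div, mul_div_cancel_right₀ _ (hDpos π).ne']
  calc _ ≤ |(∫ v, A v * g v ∂π) / (∫ v, B v * g v ∂π) - c₀| / lo₀ :=
        Real.abs_log_sub_log_le hlo₀ (hlo'.trans (hR π).1) (hlo'.trans (hR π').1)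
    _ ≤ 2 * ((hi - lo) * (b * G)) * tvDist π π' / (r * b * (c * G)) / lo₀ := by
        rw [hdiff, abs_div, abs_of_pos (hDpos π)]
        have := hD π
        gcongr
        exact (abs_nonneg _).trans htv
    _ = _ := by field_simp

/-- Contraction of the oscillation of the ratio `A / B` under a `[c, 1]`-valued kernel. -/
lemma integral_kernel_mul_ratio_bounds {V : Type*} [MeasurableSpace V] (π : Measure V)
    [IsProbabilityMeasure π] {k A B : V → ℝ} (hk : Measurable k) (hA : Measurable A)
    (hB : Measurable B) {c lo hi a b m : ℝ} (hc : 0 ≤ c) (hkb : ∀ w, c ≤ k w ∧ k w ≤ 1)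
    (ha : 0 ≤ a) (hBb : ∀ w, a ≤ B w ∧ B w ≤ b) (hlo : 0 ≤ lo) (hlohi : lo ≤ hi)
    (hAB : ∀ w, lo * B w ≤ A w ∧ A w ≤ hi * B w)
    (hm : ∫ w, A w ∂π = m * ∫ w, B w ∂π) (hmlo : lo ≤ m) (hmhi : m ≤ hi) :
    (c * m + (1 - c) * lo) * ∫ w, k w * B w ∂π ≤ ∫ w, k w * A w ∂π ∧
      ∫ w, k w * A w ∂π ≤ (c * m + (1 - c) * hi) * ∫ w, k w * B w ∂π := by
  have hB0 w : 0 ≤ B w := ha.trans (hBb w).1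
  have hk0 w : 0 ≤ k w := hc.trans (hkb w).1
  have hhi := hlo.trans hlohi
  have hAb w : 0 ≤ A w ∧ A w ≤ hi * b :=
    ⟨(mul_nonneg hlo (hB0 w)).trans (hAB w).1,
      (hAB w).2.trans (mul_le_mul_of_nonneg_left (hBb w).2 hhi)⟩
  have iB : Integrable B π := integrable_of_measurable_of_mem_Icc hB hBb
  have iA : Integrable A π := integrable_of_measurable_of_mem_Icc hA hAb
  have ikB : Integrable (fun w => k w * B w) π :=
    integrable_of_measurable_of_mem_Icc (hk.mul hB) (a := 0) (b := b) fun w =>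
      ⟨mul_nonneg (hk0 w) (hB0 w), (mul_le_of_le_one_left (hB0 w) (hkb w).2).trans (hBb w).2⟩
  have ikA : Integrable (fun w => k w * A w) π :=
    integrable_of_measurable_of_mem_Icc (hk.mul hA) (a := 0) (b := hi * b) fun w =>
      ⟨mul_nonneg (hk0 w) (hAb w).1,
        (mul_le_of_le_one_left (hAb w).1 (hkb w).2).trans (hAb w).2⟩
  have hle := (integral_kernel_mul_bounds π hk hB hc hkb ha hBb).2
  have h1 : c * (∫ w, A w ∂π - lo * ∫ w, B w ∂π)
      ≤ ∫ w, k w * A w ∂π - lo * ∫ w, k w * B w ∂π := by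
    simp only [← integral_const_mul]
    rw [← integral_sub iA (iB.const_mul _), ← integral_sub ikA (ikB.const_mul _),
      ← integral_const_mul]
    refine integral_mono ((iA.sub (iB.const_mul _)).const_mul _) (ikA.sub (ikB.const_mul _))
      fun w => ?_
    have := mul_le_mul_of_nonneg_right (hkb w).1 (sub_nonneg.2 (hAB w).1)
    simp only
    linarith
  have h2 : c * (hi * ∫ w, B w ∂π - ∫ w, A w ∂π)
      ≤ hi * ∫ w, k w * B w ∂π - ∫ w, k w * A w ∂π := by
    simp only [← integral_const_mul]
    rw [← integral_sub (iB.const_mul _) iA, ← integral_sub (ikB.const_mul _) ikA,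
      ← integral_const_mul]
    refine integral_mono (((iB.const_mul _).sub iA).const_mul _) ((ikB.const_mul _).sub ikA)
      fun w => ?_
    have := mul_le_mul_of_nonneg_right (hkb w).1 (sub_nonneg.2 (hAB w).2)
    simp only
    linarith
  rw [hm] at h1 h2
  have h3 := mul_le_mul_of_nonneg_left hle (mul_nonneg hc (sub_nonneg.2 hmlo))
  have h4 := mul_le_mul_of_nonneg_left hle (mul_nonneg hc (sub_nonneg.2 hmhi))
  constructor <;> linarith

lemma integral_mul_integral_kernel_swap {V : Type*} [MeasurableSpace V] (π π' : Measure V)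
    [IsProbabilityMeasure π] [IsProbabilityMeasure π'] {k : V → V → ℝ} {f g : V → ℝ}
    (hk : Measurable fun p : V × V => k p.1 p.2) (hf : Measurable f) (hg : Measurable g)
    {a b : ℝ} (hkb : ∀ v w, 0 ≤ k v w ∧ k v w ≤ 1) (hfb : ∀ v, 0 ≤ f v ∧ f v ≤ a)
    (hgb : ∀ v, 0 ≤ g v ∧ g v ≤ b) :
    ∫ v, f v * ∫ w, k v w * g w ∂π' ∂π = ∫ w, (∫ v, k v w * f v ∂π) * g w ∂π' := by
  have hm : Measurable fun p : V × V => f p.1 * (k p.1 p.2 * g p.2) := by fun_prop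
  have hint : Integrable (fun p : V × V => f p.1 * (k p.1 p.2 * g p.2)) (π.prod π') :=
    integrable_of_measurable_of_mem_Icc hm (a := 0) (b := a * b) fun p => by
      have h1 := mul_nonneg (hkb p.1 p.2).1 (hgb p.2).1
      exact ⟨mul_nonneg (hfb _).1 h1, mul_le_mul (hfb _).2
        ((mul_le_of_le_one_left (hgb _).1 (hkb _ _).2).trans (hgb _).2) h1
        ((hfb p.1).1.trans (hfb p.1).2)⟩
  simp only [← integral_const_mul, ← integral_mul_const]
  rw [integral_integral_swap (f := fun v w => f v * (k v w * g w)) hint]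
  congr! 4
  ring

lemma measurable_integral_kernel_mul {V : Type*} [MeasurableSpace V] (π : Measure V)
    [IsProbabilityMeasure π] {k : V → V → ℝ} {f : V → ℝ}
    (hk : Measurable fun p : V × V => k p.1 p.2) (hf : Measurable f) :
    Measurable fun w => ∫ v, k v w * f v ∂π :=
  (StronglyMeasurable.integral_prod_right (ν := π) (f := fun w v => k v w * f v)
    ((hk.comp measurable_swap).mul (hf.comp measurable_snd)).stronglyMeasurable).measurable

lemma abs_log_ratio_betaAux_sub_le {V 𝕏 : Type*} [MeasurableSpace V]
    (π π' : Measure V) [IsProbabilityMeasure π] [IsProbabilityMeasure π']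
    {K : ℕ → 𝕏 → V → V → ℝ} {ν : ℕ → ℝ}
    (hKmeas : ∀ i (y : 𝕏), Measurable fun p : V × V => K i y p.1 p.2)
    (hν0 : ∀ i, 0 < ν i) (hν1 : ∀ i, ν i ≤ 1)
    (hKlb : ∀ i (y : 𝕏) (v w : V), ν i ≤ K i y v w)
    (hKub : ∀ i (y : 𝕏) (v w : V), K i y v w ≤ 1)
    (x : ℕ → 𝕏) (m s : ℕ) {A B : V → ℝ} (hA : Measurable A) (hB : Measurable B)
    {lo₀ lo hi b : ℝ} (hlo₀ : 0 < lo₀) (hlo : lo₀ ≤ lo) (hlohi : lo ≤ hi) (hb : 0 < b)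
    (hBb : ∀ v, ν s * b ≤ B v ∧ B v ≤ b) (hAB : ∀ v, lo * B v ≤ A v ∧ A v ≤ hi * B v) :
    |Real.log ((∫ v, A v * betaAux π' K x m (s + 1) v ∂π) /
          ∫ v, B v * betaAux π' K x m (s + 1) v ∂π)
        - Real.log ((∫ v, A v * betaAux π' K x m (s + 1) v ∂π') /
          ∫ v, B v * betaAux π' K x m (s + 1) v ∂π')|
      ≤ 2 * tvDist π π' / lo₀ * ((hi - lo) * (ν s * ν (s + 1))⁻¹) := by
  obtain ⟨G, hG, hgb⟩ := betaAux_bounds π' hKmeas hν0 hν1 hKlb hKub x m (s + 1)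
  exact abs_log_ratio_sub_le π π' hA hB (betaAux_measurable π' hKmeas x m (s + 1))
    hlo₀ hlo (hν0 s) hb (hν0 (s + 1)) hG hlohi hBb hAB hgb

/-- Comparison of two priors for a pair of forward weights `A`, `B` at time `s + 1`: the ratio
`A / B` has oscillation at most `hi - lo`, which contracts as the latent variables are replaced
one at a time. -/
lemma abs_log_forward_ratio_sub_le {V 𝕏 : Type*} [MeasurableSpace V]
    (π π' : Measure V) [IsProbabilityMeasure π] [IsProbabilityMeasure π']
    {K : ℕ → 𝕏 → V → V → ℝ} {ν : ℕ → ℝ}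
    (hKmeas : ∀ i (y : 𝕏), Measurable fun p : V × V => K i y p.1 p.2)
    (hν0 : ∀ i, 0 < ν i) (hν1 : ∀ i, ν i ≤ 1)
    (hKlb : ∀ i (y : 𝕏) (v w : V), ν i ≤ K i y v w)
    (hKub : ∀ i (y : 𝕏) (v w : V), K i y v w ≤ 1)
    (x : ℕ → 𝕏) (m s : ℕ) {A B : V → ℝ} (hA : Measurable A) (hB : Measurable B)
    {lo₀ lo hi b : ℝ} (hlo₀ : 0 < lo₀) (hlo : lo₀ ≤ lo) (hlohi : lo ≤ hi) (hb : 0 < b)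
    (hBb : ∀ v, ν s * b ≤ B v ∧ B v ≤ b) (hAB : ∀ v, lo * B v ≤ A v ∧ A v ≤ hi * B v) :
    |Real.log ((∫ v, A v * betaAux π K x m (s + 1) v ∂π) /
          ∫ v, B v * betaAux π K x m (s + 1) v ∂π)
        - Real.log ((∫ v, A v * betaAux π' K x m (s + 1) v ∂π') /
          ∫ v, B v * betaAux π' K x m (s + 1) v ∂π')|
      ≤ 2 * tvDist π π' / lo₀ * ((hi - lo) * ∑ j ∈ Finset.range (m + 1),
          (ν (s + j) * ν (s + j + 1))⁻¹ * ∏ k ∈ Finset.range j, (1 - ν (s + 1 + k))) := by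
  induction m generalizing s A B lo hi b with
  | zero =>
    simpa [betaAux] using abs_log_ratio_betaAux_sub_le π π' hKmeas hν0 hν1 hKlb hKub x 0 s hA hB
      hlo₀ hlo hlohi hb hBb hAB
  | succ m ih =>
    have hνb := mul_pos (hν0 s) hb
    have hlo0 := hlo₀.trans_le hlo
    have hB0 v : 0 < B v := hνb.trans_le (hBb v).1
    have hAb v : 0 ≤ A v ∧ A v ≤ hi * b :=
      ⟨(mul_nonneg hlo0.le (hB0 v).le).trans (hAB v).1,
        (hAB v).2.trans (mul_le_mul_of_nonneg_left (hBb v).2 (hlo0.le.trans hlohi))⟩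
    have iB : Integrable B π := integrable_of_measurable_of_mem_Icc hB hBb
    have iA : Integrable A π := integrable_of_measurable_of_mem_Icc hA hAb
    have hkm := hKmeas (s + 1) (x (s + 1))
    have hkw w : Measurable fun v => K (s + 1) (x (s + 1)) v w := hkm.comp measurable_prodMk_right
    have hkb v w : ν (s + 1) ≤ K (s + 1) (x (s + 1)) v w ∧ K (s + 1) (x (s + 1)) v w ≤ 1 :=
      ⟨hKlb _ _ _ _, hKub _ _ _ _⟩
    have swap (ρ : Measure V) [IsProbabilityMeasure ρ] {f : V → ℝ} (hf : Measurable f) {a : ℝ}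
        (hfb : ∀ v, 0 ≤ f v ∧ f v ≤ a) :
        ∫ v, f v * betaAux ρ K x (m + 1) (s + 1) v ∂π
          = ∫ w, (∫ v, K (s + 1) (x (s + 1)) v w * f v ∂π)
              * betaAux ρ K x m (s + 1 + 1) w ∂ρ := by
      obtain ⟨G, hG, hgb⟩ := betaAux_bounds ρ hKmeas hν0 hν1 hKlb hKub x m (s + 1 + 1)
      exact integral_mul_integral_kernel_swap π ρ hkm hf (betaAux_measurable ρ hKmeas x m _)
        (fun v w => ⟨(hν0 _).le.trans (hkb v w).1, (hkb v w).2⟩) hfb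
        fun v => ⟨(mul_pos (hν0 _) hG).le.trans (hgb v).1, (hgb v).2⟩
    have hBb' v : 0 ≤ B v ∧ B v ≤ b := ⟨(hB0 v).le, (hBb v).2⟩
    have hIB : 0 < ∫ v, B v ∂π := hνb.trans_le (integral_mem_Icc_of_mem_Icc hB hBb).1
    set c := (∫ v, A v ∂π) / ∫ v, B v ∂π with hc
    have hcA : ∫ v, A v ∂π = c * ∫ v, B v ∂π := (div_mul_cancel₀ _ hIB.ne').symm
    have hclo : lo ≤ c := by
      rw [hc, le_div_iff₀ hIB, ← integral_const_mul]
      exact integral_mono (iB.const_mul _) iA fun v => (hAB v).1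
    have hchi : c ≤ hi := by
      rw [hc, div_le_iff₀ hIB, ← integral_const_mul]
      exact integral_mono iA (iB.const_mul _) fun v => (hAB v).2
    have hν' := hν0 (s + 1)
    have hν'1 := sub_nonneg.2 (hν1 (s + 1))
    have key := ih (s + 1) (A := fun w => ∫ v, K (s + 1) (x (s + 1)) v w * A v ∂π)
      (B := fun w => ∫ v, K (s + 1) (x (s + 1)) v w * B v ∂π)
      (measurable_integral_kernel_mul π hkm hA) (measurable_integral_kernel_mul π hkm hB)
      (lo := ν (s + 1) * c + (1 - ν (s + 1)) * lo) (hi := ν (s + 1) * c + (1 - ν (s + 1)) * hi)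
      (by nlinarith) (by gcongr) hIB
      (fun w => integral_kernel_mul_bounds π (hkw w) hB hν'.le (fun v => hkb v w) le_rfl hBb')
      (fun w => integral_kernel_mul_ratio_bounds π (hkw w) hA hB hν'.le (fun v => hkb v w) le_rfl
        hBb' hlo0.le hlohi hAB hcA hclo hchi)
    rw [← swap π hA hAb, ← swap π hB hBb', ← swap π' hA hAb, ← swap π' hB hBb'] at key
    refine (abs_sub_le _ _ _).trans ((add_le_add key
      (abs_log_ratio_betaAux_sub_le π π' hKmeas hν0 hν1 hKlb hKub x (m + 1) s hA hB
        hlo₀ hlo hlohi hb hBb hAB)).trans_eq ?_)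
    rw [Finset.sum_range_succ' _ (m + 1), ← mul_add]
    simp only [Finset.prod_range_succ', Finset.prod_range_zero, mul_one, add_zero, ← mul_assoc,
      ← Finset.sum_mul]
    simp only [Nat.add_right_comm _ _ 1, ← add_assoc]
    ring

theorem condP_prior_increment {V 𝕏 : Type*} [MeasurableSpace V] [Countable 𝕏]
    (π π' : Measure V) [IsProbabilityMeasure π] [IsProbabilityMeasure π']
    (K : ℕ → 𝕏 → V → V → ℝ) (ν : ℕ → ℝ)
    (hKmeas : ∀ i (y : 𝕏), Measurable fun p : V × V => K i y p.1 p.2)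
    (hKsum : ∀ i (v w : V), HasSum (fun y : 𝕏 => K i y v w) 1)
    (hν0 : ∀ i, 0 < ν i) (hν1 : ∀ i, ν i ≤ 1)
    (hKlb : ∀ i (y : 𝕏) (v w : V), ν i ≤ K i y v w)
    (hKub : ∀ i (y : 𝕏) (v w : V), K i y v w ≤ 1)
    (x : ℕ → 𝕏) (q n : ℕ) (hq : 1 ≤ q) (hqn : q ≤ n) :
    |Real.log (condP π K x q n) - Real.log (condP π' K x q n)|
      ≤ 2 * (∑ ℓ ∈ Finset.range (n + 2 - q),
          (ν q * ν (q + ℓ - 1) * ν (q + ℓ))⁻¹ *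
            ∏ k ∈ Finset.Icc (q + 1) (q + ℓ - 1), (1 - ν k)) * tvDist π π' := by
  obtain ⟨m, rfl⟩ := Nat.exists_eq_add_of_le hqn
  have hkm := hKmeas q (x q)
  have hkb v w : 0 ≤ K q (x q) v w ∧ K q (x q) v w ≤ 1 :=
    ⟨(hν0 q).le.trans (hKlb _ _ _ _), hKub _ _ _ _⟩
  have swap (ρ ρ' : Measure V) [IsProbabilityMeasure ρ] [IsProbabilityMeasure ρ'] :
      ∫ v, betaAux ρ' K x (m + 1) q v ∂ρ
        = ∫ w, (∫ v, K q (x q) v w ∂ρ) * betaAux ρ' K x m (q + 1) w ∂ρ' := by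
    obtain ⟨G, hG, hgb⟩ := betaAux_bounds ρ' hKmeas hν0 hν1 hKlb hKub x m (q + 1)
    simpa [betaAux] using integral_mul_integral_kernel_swap ρ ρ' hkm (f := fun _ => 1)
      measurable_const (betaAux_measurable ρ' hKmeas x m (q + 1)) (a := 1) hkb (by simp)
      fun v => ⟨(mul_pos (hν0 _) hG).le.trans (hgb v).1, (hgb v).2⟩
  have hcond (ρ : Measure V) : condP ρ K x q (q + m)
      = (∫ v, betaAux ρ K x (m + 1) q v ∂ρ) / ∫ v, betaAux ρ K x m (q + 1) v ∂ρ := by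
    rw [condP, margP, margP, show q + m + 1 - q = m + 1 by omega,
      show q + m + 1 - (q + 1) = m by omega]
  have hT := tvDist_nonneg π π'
  have hhead : |Real.log ((∫ v, betaAux π' K x (m + 1) q v ∂π) /
        ∫ v, betaAux π' K x m (q + 1) v ∂π')
      - Real.log ((∫ v, betaAux π' K x (m + 1) q v ∂π') /
        ∫ v, betaAux π' K x m (q + 1) v ∂π')| ≤ tvDist π π' / ν q := by
    obtain ⟨G, hG, hgb⟩ := betaAux_bounds π' hKmeas hν0 hν1 hKlb hKub x (m + 1) q
    obtain ⟨G', hG', hgb'⟩ := betaAux_bounds π' hKmeas hν0 hν1 hKlb hKub x m (q + 1)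
    have hm := betaAux_measurable π' hKmeas x (m + 1) q
    have hνG := mul_pos (hν0 q) hG
    have hN (ρ : Measure V) [IsProbabilityMeasure ρ] :=
      (integral_mem_Icc_of_mem_Icc (μ := ρ) hm hgb).1
    have hD := (mul_pos (hν0 (q + 1)) hG').trans_le
      (integral_mem_Icc_of_mem_Icc (μ := π') (betaAux_measurable π' hKmeas x m (q + 1)) hgb').1
    rw [Real.log_div (hνG.trans_le (hN π)).ne' hD.ne',
      Real.log_div (hνG.trans_le (hN π')).ne' hD.ne', sub_sub_sub_cancel_right]
    calc _ ≤ _ / (ν q * G) := Real.abs_log_sub_log_le hνG (hN π) (hN π')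
      _ ≤ G * tvDist π π' / (ν q * G) := by
        gcongr
        exact abs_integral_sub_le_of_nonneg π π' hm hG.le
          fun z => ⟨hνG.le.trans (hgb z).1, (hgb z).2⟩
      _ = _ := by field_simp
  have hh w : ν q ≤ ∫ v, K q (x q) v w ∂π ∧ ∫ v, K q (x q) v w ∂π ≤ 1 :=
    integral_mem_Icc_of_mem_Icc (hkm.comp measurable_prodMk_right)
      fun v => ⟨hKlb _ _ _ _, hKub _ _ _ _⟩
  have htail := abs_log_forward_ratio_sub_le π π' hKmeas hν0 hν1 hKlb hKub x m q
    (A := fun w => ∫ v, K q (x q) v w ∂π) (B := fun _ => 1)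
    (by simpa using measurable_integral_kernel_mul π hkm (measurable_const (a := (1 : ℝ))))
    measurable_const (hν0 q) le_rfl (hi := ν q + 1) (by linarith) one_pos
    (fun _ => by simpa using hν1 q) fun w => by
      simpa using ⟨(hh w).1, (hh w).2.trans (by linarith [hν0 q])⟩
  simp only [one_mul] at htail
  rw [← swap π π, ← swap π π'] at htail
  rw [hcond, hcond]
  refine (abs_sub_le _ _ _).trans ((add_le_add htail hhead).trans ?_)
  rw [show q + m + 2 - q = m + 1 + 1 by omega, Finset.sum_range_succ' _ (m + 1)]
  have hprod (j : ℕ) : ∏ k ∈ Finset.Icc (q + 1) (q + (j + 1) - 1), (1 - ν k)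
      = ∏ k ∈ Finset.range j, (1 - ν (q + 1 + k)) := by
    rw [← Finset.Ico_add_one_right_eq_Icc, Finset.prod_Ico_eq_prod_range]
    congr! 2
    omega
  have hsum : ∑ j ∈ Finset.range (m + 1), (ν q * ν (q + (j + 1) - 1) * ν (q + (j + 1)))⁻¹ *
        ∏ k ∈ Finset.Icc (q + 1) (q + (j + 1) - 1), (1 - ν k)
      = (ν q)⁻¹ * ∑ j ∈ Finset.range (m + 1),
          (ν (q + j) * ν (q + j + 1))⁻¹ * ∏ k ∈ Finset.range j, (1 - ν (q + 1 + k)) := by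
    rw [Finset.mul_sum]
    refine Finset.sum_congr rfl fun j _ => ?_
    rw [hprod, ← add_assoc, Nat.add_sub_cancel, mul_assoc (ν q), mul_inv (ν q), mul_assoc]
  have hfirst : (ν q)⁻¹ ≤ (ν q * ν (q - 1) * ν q)⁻¹ := by
    have h1 := hν0 q
    have h2 := hν0 (q - 1)
    refine inv_anti₀ (by positivity) ?_
    rw [mul_assoc]
    exact mul_le_of_le_one_right h1.le (mul_le_one₀ (hν1 _) h1.le (hν1 _))
  rw [hsum]
  simp only [add_zero]
  rw [Finset.Icc_eq_empty (by omega : ¬ q + 1 ≤ q - 1), Finset.prod_empty, mul_one,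
    add_sub_cancel_left, one_mul, div_eq_mul_inv, div_eq_mul_inv]
  have h3 := mul_le_mul_of_nonneg_left hfirst hT
  have h4 : 0 ≤ tvDist π π' * (ν q)⁻¹ := mul_nonneg hT (inv_nonneg.2 (hν0 q).le)
  linarith
end

section
/- In the latent-variable model with kernels K_i satisfying ν_i ≤ K_i ≤ 1, if X̃^{q̃} is obtained from X by changing only the coordinate q̃ (i.e. X̃_k = X_k for k ≠ q̃), then for any 1 ≤ q ≤ q̃ ≤ n: |log P(X_q | X_{q+1:n}) − log P(X̃^{q̃}_q | X̃^{q̃}_{q+1:n})| ≤ ν_q^{-1} · ∏_{k=q+1}^{q̃−1}(1−ν_k). -/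
open MeasureTheory

section BoundedPositive

variable {V 𝕏 : Type*} [MeasurableSpace V]

/-- Measurable functions bounded above and bounded away from `0`. -/
def BoundedPositive {α : Type*} [MeasurableSpace α] (f : α → ℝ) : Prop :=
  Measurable f ∧ ∃ c > 0, ∃ M, ∀ a, c ≤ f a ∧ f a ≤ M

namespace BoundedPositive

variable {α : Type*} [MeasurableSpace α]

theorem pos {f : α → ℝ} (hf : BoundedPositive f) (a : α) : 0 < f a := by
  obtain ⟨-, c, hc, M, h⟩ := hf
  exact hc.trans_le (h a).1

theorem one : BoundedPositive (fun _ : α => (1 : ℝ)) :=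
  ⟨measurable_const, 1, one_pos, 1, fun _ => ⟨le_rfl, le_rfl⟩⟩

theorem integrable {μ : Measure α} [IsFiniteMeasure μ] {f : α → ℝ} (hf : BoundedPositive f) :
    Integrable f μ := by
  have hpos := hf.pos
  obtain ⟨hm, c, hc, M, h⟩ := hf
  refine Integrable.of_bound hm.aestronglyMeasurable M (Filter.Eventually.of_forall fun a => ?_)
  rw [Real.norm_of_nonneg (hpos a).le]
  exact (h a).2

theorem comp {γ : Type*} [MeasurableSpace γ] {f : α → ℝ} (hf : BoundedPositive f) {g : γ → α}
    (hg : Measurable g) : BoundedPositive (fun x => f (g x)) := by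
  obtain ⟨hm, c, hc, M, h⟩ := hf
  exact ⟨hm.comp hg, c, hc, M, fun a => h (g a)⟩

theorem mul {f g : α → ℝ} (hf : BoundedPositive f) (hg : BoundedPositive g) :
    BoundedPositive (fun a => f a * g a) := by
  have hfpos := hf.pos
  have hgpos := hg.pos
  obtain ⟨hm, c, hc, M, h⟩ := hf
  obtain ⟨hm', c', hc', M', h'⟩ := hg
  refine ⟨hm.mul hm', c * c', mul_pos hc hc', M * M', fun a => ⟨?_, ?_⟩⟩
  · exact mul_le_mul (h a).1 (h' a).1 hc'.le (hfpos a).le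
  · exact mul_le_mul (h a).2 (h' a).2 (hgpos a).le ((hfpos a).le.trans (h a).2)

theorem integral_pos {μ : Measure α} [IsProbabilityMeasure μ] {f : α → ℝ}
    (hf : BoundedPositive f) : 0 < ∫ a, f a ∂μ := by
  have hi := hf.integrable (μ := μ)
  obtain ⟨-, c, hc, M, h⟩ := hf
  calc 0 < c := hc
    _ = ∫ _, c ∂μ := by simp
    _ ≤ _ := integral_mono (integrable_const c) hi fun a => (h a).1

theorem integral_right {μ : Measure V} [IsProbabilityMeasure μ] {f : α × V → ℝ}
    (hf : BoundedPositive f) : BoundedPositive (fun a => ∫ w, f (a, w) ∂μ) := by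
  have hi (a : α) : Integrable (fun w => f (a, w)) μ := (hf.comp measurable_prodMk_left).integrable
  obtain ⟨hm, c, hc, M, h⟩ := hf
  refine ⟨hm.stronglyMeasurable.integral_prod_right'.measurable, c, hc, M, fun a => ⟨?_, ?_⟩⟩
  · calc c = ∫ _, c ∂μ := by simp
      _ ≤ _ := integral_mono (integrable_const c) (hi a) fun w => (h _).1
  · calc ∫ w, f (a, w) ∂μ ≤ ∫ _, M ∂μ :=
          integral_mono (hi a) (integrable_const M) fun w => (h _).2
      _ = M := by simp

end BoundedPositive

theorem boundedPositive_betaAux {π : Measure V} [IsProbabilityMeasure π]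
    {K : ℕ → 𝕏 → V → V → ℝ} (hK : ∀ i y, BoundedPositive fun p : V × V => K i y p.1 p.2)
    (x : ℕ → 𝕏) (m i : ℕ) : BoundedPositive (betaAux π K x m i) := by
  induction m generalizing i with
  | zero => exact BoundedPositive.one
  | succ m ih =>
    exact ((hK i (x i)).mul ((ih (i + 1)).comp measurable_snd)).integral_right

theorem integral_mul_betaAux_succ {π : Measure V} [IsProbabilityMeasure π]
    {K : ℕ → 𝕏 → V → V → ℝ} (hK : ∀ i y, BoundedPositive fun p : V × V => K i y p.1 p.2)
    (x : ℕ → 𝕏) (m i : ℕ) {A : V → ℝ} (hA : BoundedPositive A) :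
    ∫ v, A v * betaAux π K x (m + 1) i v ∂π =
      ∫ w, (∫ v, A v * K i (x i) v w ∂π) * betaAux π K x m (i + 1) w ∂π := by
  have hint : BoundedPositive fun p : V × V =>
      A p.1 * (K i (x i) p.1 p.2 * betaAux π K x m (i + 1) p.2) :=
    (hA.comp measurable_fst).mul
      ((hK i (x i)).mul ((boundedPositive_betaAux hK x m (i + 1)).comp measurable_snd))
  simp_rw [betaAux, ← integral_const_mul, ← integral_mul_const]
  rw [integral_integral_swap hint.integrable]
  simp_rw [mul_assoc]

theorem integral_mul_ratio_mem_Icc {μ : Measure V} [IsProbabilityMeasure μ] {A C f : V → ℝ}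
    {l u : ℝ} (hA : BoundedPositive A) (hC : BoundedPositive C) (hf : BoundedPositive f)
    (hl : ∀ v, l * C v ≤ A v) (hu : ∀ v, A v ≤ u * C v) :
    (∫ v, A v * f v ∂μ) / (∫ v, C v * f v ∂μ) ∈ Set.Icc l u := by
  have hpos := (hC.mul hf).integral_pos (μ := μ)
  have hAi := (hA.mul hf).integrable (μ := μ)
  have hCi := (hC.mul hf).integrable (μ := μ)
  constructor
  · rw [le_div_iff₀ hpos, ← integral_const_mul]
    refine integral_mono (hCi.const_mul l) hAi fun v => ?_
    simpa only [mul_assoc] using mul_le_mul_of_nonneg_right (hl v) (hf.pos v).le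
  · rw [div_le_iff₀ hpos, ← integral_const_mul]
    refine integral_mono hAi (hCi.const_mul u) fun v => ?_
    simpa only [mul_assoc] using mul_le_mul_of_nonneg_right (hu v) (hf.pos v).le

/-- Averaging against a kernel with values in `[ε, 1]` shrinks the range of the ratio of two
functions by a factor `1 - ε`. -/
theorem exists_ratio_bounds_integral_mul {μ : Measure V} [IsProbabilityMeasure μ]
    {k : V → V → ℝ} {ε : ℝ} (hk : BoundedPositive fun p : V × V => k p.1 p.2)
    (hε : 0 ≤ ε) (hlb : ∀ v w, ε ≤ k v w) (hub : ∀ v w, k v w ≤ 1)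
    {A C : V → ℝ} (hA : BoundedPositive A) (hC : BoundedPositive C) {l u : ℝ}
    (hl : ∀ v, l * C v ≤ A v) (hu : ∀ v, A v ≤ u * C v) :
    ∃ l' u', u' - l' = (1 - ε) * (u - l) ∧
      (∀ w, l' * ∫ v, C v * k v w ∂μ ≤ ∫ v, A v * k v w ∂μ) ∧
      (∀ w, ∫ v, A v * k v w ∂μ ≤ u' * ∫ v, C v * k v w ∂μ) := by
  have hcol (w : V) : BoundedPositive fun v => k v w := hk.comp measurable_prodMk_right
  have hAi := hA.integrable (μ := μ)
  have hCi := hC.integrable (μ := μ)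
  have hAk (w : V) := (hA.mul (hcol w)).integrable (μ := μ)
  have hCk (w : V) := (hC.mul (hcol w)).integrable (μ := μ)
  set a := ∫ v, A v ∂μ
  set c := ∫ v, C v ∂μ
  have hc : 0 < c := hC.integral_pos
  have hle (w : V) : ∫ v, C v * k v w ∂μ ≤ c :=
    integral_mono (hCk w) hCi fun v => mul_le_of_le_one_right (hC.pos v).le (hub v w)
  have hla : l * c ≤ a := by
    rw [← integral_const_mul]
    exact integral_mono (hCi.const_mul l) hAi hl
  have hau : a ≤ u * c := by
    rw [← integral_const_mul]
    exact integral_mono hAi (hCi.const_mul u) hu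
  have hlow (w : V) : ε * (a - l * c) ≤
      ∫ v, A v * k v w ∂μ - l * ∫ v, C v * k v w ∂μ := by
    rw [← integral_const_mul, ← integral_const_mul, ← integral_sub hAi (hCi.const_mul l),
      ← integral_sub (hAk w) ((hCk w).const_mul l), ← integral_const_mul]
    refine integral_mono ((hAi.sub (hCi.const_mul l)).const_mul ε)
      ((hAk w).sub ((hCk w).const_mul l)) fun v => ?_
    change ε * (A v - l * C v) ≤ A v * k v w - l * (C v * k v w)
    linarith [mul_le_mul_of_nonneg_right (hlb v w) (sub_nonneg.2 (hl v))]
  have hupp (w : V) : ε * (u * c - a) ≤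
      u * ∫ v, C v * k v w ∂μ - ∫ v, A v * k v w ∂μ := by
    rw [← integral_const_mul, ← integral_const_mul, ← integral_sub (hCi.const_mul u) hAi,
      ← integral_sub ((hCk w).const_mul u) (hAk w), ← integral_const_mul]
    refine integral_mono (((hCi.const_mul u).sub hAi).const_mul ε)
      (((hCk w).const_mul u).sub (hAk w)) fun v => ?_
    change ε * (u * C v - A v) ≤ u * (C v * k v w) - A v * k v w
    linarith [mul_le_mul_of_nonneg_right (hlb v w) (sub_nonneg.2 (hu v))]
  refine ⟨l + ε * (a - l * c) / c, u - ε * (u * c - a) / c, ?_, fun w => ?_, fun w => ?_⟩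
  · field_simp
    ring
  · have h : ε * (a - l * c) / c * ∫ v, C v * k v w ∂μ ≤ ε * (a - l * c) := by
      rw [div_mul_eq_mul_div, div_le_iff₀ hc]
      exact mul_le_mul_of_nonneg_left (hle w) (mul_nonneg hε (sub_nonneg.2 hla))
    linarith [hlow w]
  · have h : ε * (u * c - a) / c * ∫ v, C v * k v w ∂μ ≤ ε * (u * c - a) := by
      rw [div_mul_eq_mul_div, div_le_iff₀ hc]
      exact mul_le_mul_of_nonneg_left (hle w) (mul_nonneg hε (sub_nonneg.2 hau))
    linarith [hupp w]

theorem abs_integral_mul_betaAux_ratio_sub_le {π : Measure V} [IsProbabilityMeasure π]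
    {K : ℕ → 𝕏 → V → V → ℝ} {ν : ℕ → ℝ}
    (hK : ∀ i y, BoundedPositive fun p : V × V => K i y p.1 p.2) (hν0 : ∀ i, 0 < ν i)
    (hlb : ∀ i y v w, ν i ≤ K i y v w) (hub : ∀ i y v w, K i y v w ≤ 1)
    {x y : ℕ → 𝕏} (d m i : ℕ) (hxy : ∀ k < i + d, y k = x k) {A C : V → ℝ}
    (hA : BoundedPositive A) (hC : BoundedPositive C) {l u : ℝ}
    (hl : ∀ v, l * C v ≤ A v) (hu : ∀ v, A v ≤ u * C v) :
    |(∫ v, A v * betaAux π K x (m + d) i v ∂π) / (∫ v, C v * betaAux π K x (m + d) i v ∂π) -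
      (∫ v, A v * betaAux π K y (m + d) i v ∂π) / (∫ v, C v * betaAux π K y (m + d) i v ∂π)|
      ≤ (u - l) * ∏ k ∈ Finset.Ico i (i + d), (1 - ν k) := by
  induction d generalizing i A C l u with
  | zero =>
    have hx := integral_mul_ratio_mem_Icc (μ := π) hA hC
      (boundedPositive_betaAux (π := π) hK x (m + 0) i) hl hu
    have hy := integral_mul_ratio_mem_Icc (μ := π) hA hC
      (boundedPositive_betaAux (π := π) hK y (m + 0) i) hl hu
    simpa using abs_sub_le_of_le_of_le hx.1 hx.2 hy.1 hy.2
  | succ d ih =>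
    have hswap : BoundedPositive fun p : V × V => K i (x i) p.2 p.1 :=
      (hK i (x i)).comp measurable_swap
    obtain ⟨l', u', hlu, hl', hu'⟩ := exists_ratio_bounds_integral_mul (μ := π) (hK i (x i))
      (hν0 i).le (hlb i (x i)) (hub i (x i)) hA hC hl hu
    have havg {f : V → ℝ} (hf : BoundedPositive f) :
        BoundedPositive fun w => ∫ v, f v * K i (x i) v w ∂π :=
      ((hf.comp measurable_snd).mul hswap).integral_right
    have h := ih (i + 1) (fun k hk => hxy k (by omega)) (havg hA) (havg hC) hl' hu'
    rw [← add_assoc m d 1]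
    simp only [integral_mul_betaAux_succ hK _ _ _ hA, integral_mul_betaAux_succ hK _ _ _ hC,
      hxy i (by omega)]
    refine h.trans_eq ?_
    rw [Finset.prod_eq_prod_Ico_succ_bot (show i < i + (d + 1) by omega), hlu,
      show i + 1 + d = i + (d + 1) by omega]
    ring

end BoundedPositive

theorem abs_log_sub_log_le_inv_mul {ε a b : ℝ} (hε : 0 < ε) (ha : ε ≤ a) (hb : ε ≤ b) :
    |Real.log a - Real.log b| ≤ ε⁻¹ * |a - b| := by
  have key {s t : ℝ} (hs : ε ≤ s) (ht : ε ≤ t) : Real.log s - Real.log t ≤ ε⁻¹ * |s - t| := by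
    have hs0 := hε.trans_le hs
    have ht0 := hε.trans_le ht
    rw [← Real.log_div hs0.ne' ht0.ne']
    calc Real.log (s / t) ≤ s / t - 1 := Real.log_le_sub_one_of_pos (div_pos hs0 ht0)
      _ = t⁻¹ * (s - t) := by field_simp
      _ ≤ t⁻¹ * |s - t| := mul_le_mul_of_nonneg_left (le_abs_self _) (inv_pos.2 ht0).le
      _ ≤ ε⁻¹ * |s - t| := mul_le_mul_of_nonneg_right (inv_anti₀ hε ht) (abs_nonneg _)
  refine abs_sub_le_iff.2 ⟨key ha hb, ?_⟩
  rw [abs_sub_comm]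
  exact key hb ha

theorem condP_bounded_difference {V 𝕏 : Type*} [MeasurableSpace V] [Countable 𝕏]
    (π : Measure V) [IsProbabilityMeasure π]
    (K : ℕ → 𝕏 → V → V → ℝ) (ν : ℕ → ℝ)
    (hKmeas : ∀ i (y : 𝕏), Measurable fun p : V × V => K i y p.1 p.2)
    (hKsum : ∀ i (v w : V), HasSum (fun y : 𝕏 => K i y v w) 1)
    (hν0 : ∀ i, 0 < ν i) (hν1 : ∀ i, ν i ≤ 1)
    (hKlb : ∀ i (y : 𝕏) (v w : V), ν i ≤ K i y v w)
    (hKub : ∀ i (y : 𝕏) (v w : V), K i y v w ≤ 1)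
    (x xt : ℕ → 𝕏) (q qt n : ℕ) (hq : 1 ≤ q) (hqqt : q ≤ qt) (hqtn : qt ≤ n)
    (hxt : ∀ k, k ≠ qt → xt k = x k) :
    |Real.log (condP π K x q n) - Real.log (condP π K xt q n)|
      ≤ (ν q)⁻¹ * ∏ k ∈ Finset.Icc (q + 1) (qt - 1), (1 - ν k) := by
  have hK (i : ℕ) (y : 𝕏) : BoundedPositive fun p : V × V => K i y p.1 p.2 :=
    ⟨hKmeas i y, ν i, hν0 i, 1, fun p => ⟨hKlb i y p.1 p.2, hKub i y p.1 p.2⟩⟩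
  have hcol (y : 𝕏) (w : V) : BoundedPositive fun v => K q y v w :=
    (hK q y).comp measurable_prodMk_right
  have hg (y : 𝕏) : BoundedPositive fun w => ∫ v, 1 * K q y v w ∂π := by
    simp only [one_mul]
    exact ((hK q y).comp measurable_swap).integral_right
  have hglb (y : 𝕏) (w : V) : ν q * 1 ≤ ∫ v, 1 * K q y v w ∂π := by
    simp only [one_mul, mul_one]
    calc ν q = ∫ _, ν q ∂π := by simp
      _ ≤ _ := integral_mono (integrable_const _) (hcol y w).integrable fun v => hKlb q y v w
  have hgub (y : 𝕏) (w : V) : ∫ v, 1 * K q y v w ∂π ≤ 1 * 1 := by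
    simp only [one_mul]
    calc ∫ v, K q y v w ∂π ≤ ∫ _, (1 : ℝ) ∂π :=
          integral_mono (hcol y w).integrable (integrable_const _) fun v => hKub q y v w
      _ = 1 := by simp
  have hcond (y : ℕ → 𝕏) : condP π K y q n =
      (∫ w, (∫ v, 1 * K q (y q) v w ∂π) * betaAux π K y (n - q) (q + 1) w ∂π) /
        ∫ w, 1 * betaAux π K y (n - q) (q + 1) w ∂π := by
    rw [← integral_mul_betaAux_succ hK y (n - q) q BoundedPositive.one, condP, margP, margP,
      show n + 1 - q = n - q + 1 by omega, show n + 1 - (q + 1) = n - q by omega]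
    simp only [one_mul]
  have hmem (y : ℕ → 𝕏) : condP π K y q n ∈ Set.Icc (ν q) 1 := by
    rw [hcond y]
    exact integral_mul_ratio_mem_Icc (hg (y q)) BoundedPositive.one
      (boundedPositive_betaAux hK y (n - q) (q + 1)) (hglb (y q)) (hgub (y q))
  refine (abs_log_sub_log_le_inv_mul (hν0 q) (hmem x).1 (hmem xt).1).trans
    (mul_le_mul_of_nonneg_left ?_ (inv_pos.2 (hν0 q)).le)
  rcases hqqt.eq_or_lt with rfl | hlt
  · rw [Finset.Icc_eq_empty (by omega), Finset.prod_empty]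
    have h := abs_sub_le_of_le_of_le (hmem x).1 (hmem x).2 (hmem xt).1 (hmem xt).2
    linarith [hν0 q]
  · have h := abs_integral_mul_betaAux_ratio_sub_le (π := π) (x := x) (y := xt) hK hν0 hKlb hKub
      (qt - (q + 1)) (n - qt + 1) (q + 1) (fun k hk => hxt k (by omega)) (hg (x q))
      BoundedPositive.one (l := 0) (u := 1)
      (fun w => (zero_mul (1 : ℝ)).trans_le ((hg (x q)).pos w).le) (hgub (x q))
    rw [show n - qt + 1 + (qt - (q + 1)) = n - q by omega,
      show q + 1 + (qt - (q + 1)) = qt by omega, sub_zero, one_mul] at h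
    rw [hcond x, hcond xt, hxt q hlt.ne,
      show Finset.Icc (q + 1) (qt - 1) = Finset.Ico (q + 1) qt by
        ext k
        simp only [Finset.mem_Icc, Finset.mem_Ico]
        omega]
    exact h
end

section
/- In the round-robin graph E^{n,N}_RR with 2 ≤ n < N/4 and N even, let X_q denote the set of edges between nodes at distance q and q+1 from node 1 together with edges between two nodes at distance q+1. Then for all 2 ≤ q ≤ Q−1 (Q the quotient of (N/2−1) by (n−1)), |X_q| = n(n−1). -/
/-- `rrCycle N j` : the node sitting at cyclic position `j` in the initial
round-robin arrangement of the `N` nodes (`N` even).  Position `0` holds the fixed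
node `1`; the cycle runs along the top row `1, 3, …, N-1` and then back along the
bottom row `N, N-2, …, 2`. -/
def rrCycle (N j : ℕ) : ℕ := if j ≤ N / 2 - 1 then 2 * j + 1 else 2 * (N - j)

/-- `rrNodeAt N t j` : the node sitting at cyclic position `j` during round `t ≥ 1`
of the round-robin scheduling: node `1` stays at position `0` and all other nodes
rotate one step at each round. -/
def rrNodeAt (N t j : ℕ) : ℕ :=
  if j = 0 then 1
  else rrCycle N (1 + (j - 1 + ((N - 1) - (t - 1) % (N - 1))) % (N - 1))

/-- The pairing relation produced by the first `n` rounds of the round-robin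
scheduling: at each round, the node at position `j` plays the node at the facing
position `N - 1 - j`. -/
def rrRel (n N a b : ℕ) : Prop :=
  ∃ t ∈ Finset.Icc 1 n, ∃ j ∈ Finset.range (N / 2),
    a = rrNodeAt N t j ∧ b = rrNodeAt N t (N - 1 - j)

/-- The round-robin graph `E^{n,N}_RR` on the nodes `1, …, N`. -/
def rrGraph (n N : ℕ) : SimpleGraph ℕ := SimpleGraph.fromRel (rrRel n N)

/-- The node at cyclic position `-x` modulo `2 * h + 1` among `2 * h + 2` nodes. -/
def rrIntNode (h : ℕ) (x : ℤ) : ℕ :=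
  rrCycle (2 * h + 2) (2 * h + 1 - (x % (2 * h + 1)).toNat)

/-- The nodes covered by the interval `[-(r - 1) m, r m]`, together with node `1`. -/
def rrBall (m h r : ℕ) (v : ℕ) : Prop :=
  v = 1 ∨ ∃ x : ℤ, -((r : ℤ) * m) + m ≤ x ∧ x ≤ r * m ∧ v = rrIntNode h x

theorem rrIntNode_eq_iff (h : ℕ) (x y : ℤ) :
    rrIntNode h x = rrIntNode h y ↔ x ≡ y [ZMOD (2 * h + 1)] := by
  have hx0 := Int.emod_nonneg x (b := 2 * h + 1) (by omega)
  have hx1 := Int.emod_lt_of_pos x (b := 2 * h + 1) (by omega)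
  have hy0 := Int.emod_nonneg y (b := 2 * h + 1) (by omega)
  have hy1 := Int.emod_lt_of_pos y (b := 2 * h + 1) (by omega)
  unfold rrIntNode rrCycle Int.ModEq
  generalize x % (2 * h + 1) = a at *
  generalize y % (2 * h + 1) = b at *
  split_ifs <;> omega

theorem rrIntNode_mem_Icc (h : ℕ) (x : ℤ) :
    2 ≤ rrIntNode h x ∧ rrIntNode h x ≤ 2 * h + 2 := by
  have hx0 := Int.emod_nonneg x (b := 2 * h + 1) (by omega)
  have hx1 := Int.emod_lt_of_pos x (b := 2 * h + 1) (by omega)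
  unfold rrIntNode rrCycle
  generalize x % (2 * h + 1) = a at *
  split_ifs <;> omega

theorem rrIntNode_ne_one (h : ℕ) (x : ℤ) : rrIntNode h x ≠ 1 := by
  have := rrIntNode_mem_Icc h x
  omega

theorem eq_of_rrIntNode_eq {h : ℕ} {x y : ℤ} (hxy : rrIntNode h x = rrIntNode h y)
    (h₁ : x - y ≤ 2 * h) (h₂ : y - x ≤ 2 * h) : x = y := by
  have hd := ((rrIntNode_eq_iff h x y).1 hxy).symm.dvd
  have := Int.eq_zero_of_abs_lt_dvd hd (by rw [abs_lt]; omega)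
  omega

theorem rrNodeAt_eq_rrIntNode (h s j : ℕ) (hs : s < 2 * h + 1) (hj : 1 ≤ j) :
    rrNodeAt (2 * h + 2) (s + 1) j = rrIntNode h (s - j) := by
  have hM : 2 * h + 2 - 1 = 2 * h + 1 := by omega
  unfold rrNodeAt rrIntNode
  rw [if_neg (by omega), hM, Nat.add_sub_cancel, Nat.mod_eq_of_lt hs]
  congr 1
  have hlt := Nat.mod_lt (j - 1 + (2 * h + 1 - s)) (y := 2 * h + 1) (by omega)
  have hdiv := Nat.mod_add_div (j - 1 + (2 * h + 1 - s)) (2 * h + 1)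
  set a := (j - 1 + (2 * h + 1 - s)) % (2 * h + 1)
  set c := (j - 1 + (2 * h + 1 - s)) / (2 * h + 1)
  have hz : ((s : ℤ) - j) = (2 * h - a) + (2 * h + 1) * (-c) := by
    zify [hj, hs.le] at hdiv
    linarith
  rw [hz, Int.add_mul_emod_self_left, Int.emod_eq_of_lt (by omega) (by omega)]
  omega

theorem rrRel_iff (m h : ℕ) (hm : m < 2 * h + 1) (a b : ℕ) :
    rrRel (m + 1) (2 * h + 2) a b ↔ ∃ s k : ℤ, 0 ≤ s ∧ s ≤ m ∧ 0 ≤ k ∧ k ≤ h ∧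
      a = (if k = 0 then 1 else rrIntNode h (s - k)) ∧ b = rrIntNode h (s + k) := by
  have key : ∀ s j : ℕ, s ≤ m → j ≤ h →
      rrNodeAt (2 * h + 2) (s + 1) j =
        (if (j : ℤ) = 0 then 1 else rrIntNode h (s - j)) ∧
      rrNodeAt (2 * h + 2) (s + 1) (2 * h + 2 - 1 - j) = rrIntNode h (s + j) := by
    intro s j hs hj
    constructor
    · split_ifs with h0
      · simp [rrNodeAt, show j = 0 by omega]
      · exact rrNodeAt_eq_rrIntNode h s j (by omega) (by omega)
    · rw [rrNodeAt_eq_rrIntNode h s _ (by omega) (by omega), rrIntNode_eq_iff]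
      refine Int.modEq_iff_dvd.2 ⟨1, ?_⟩
      omega
  constructor
  · rintro ⟨t, ht, j, hj, rfl, rfl⟩
    rw [Finset.mem_Icc] at ht
    rw [Finset.mem_range] at hj
    obtain ⟨s, rfl⟩ : ∃ s, t = s + 1 := ⟨t - 1, by omega⟩
    obtain ⟨h₁, h₂⟩ := key s j (by omega) (by omega)
    exact ⟨s, j, by omega, by omega, by omega, by omega, h₁, h₂⟩
  · rintro ⟨s, k, hs0, hs, hk0, hk, rfl, rfl⟩
    lift s to ℕ using hs0
    lift k to ℕ using hk0
    obtain ⟨h₁, h₂⟩ := key s k (by omega) (by omega)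
    exact ⟨s + 1, by simp; omega, k, by simp; omega, h₁.symm, h₂.symm⟩

theorem rrGraph_adj_rrIntNode {m h : ℕ} (hm : m < 2 * h + 1) {x y s : ℤ} (hs0 : 0 ≤ s)
    (hs : s ≤ m) (hxy : x + y = 2 * s) (hne : rrIntNode h x ≠ rrIntNode h y) :
    (rrGraph (m + 1) (2 * h + 2)).Adj (rrIntNode h x) (rrIntNode h y) := by
  rw [rrGraph, SimpleGraph.fromRel_adj, rrRel_iff m h hm, rrRel_iff m h hm]
  refine ⟨hne, ?_⟩
  have he0 := Int.emod_nonneg (x - s) (b := 2 * h + 1) (by omega)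
  have he1 := Int.emod_lt_of_pos (x - s) (b := 2 * h + 1) (by omega)
  have hdiv := Int.emod_add_mul_ediv (x - s) (2 * h + 1)
  set e := (x - s) % (2 * h + 1)
  set c := (x - s) / (2 * h + 1)
  have hx : rrIntNode h x = rrIntNode h (s + e) :=
    (rrIntNode_eq_iff _ _ _).2 (Int.modEq_iff_dvd.2 ⟨-c, by linarith⟩)
  have hy : rrIntNode h y = rrIntNode h (s - e) :=
    (rrIntNode_eq_iff _ _ _).2 (Int.modEq_iff_dvd.2 ⟨c, by linarith⟩)
  have hepos : e ≠ 0 := by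
    intro h0
    apply hne
    rw [hx, hy, h0, add_zero, sub_zero]
  rcases le_or_gt e h with hle | hgt
  · right
    exact ⟨s, e, hs0, hs, he0, hle, by rw [if_neg hepos, hy], hx⟩
  · left
    refine ⟨s, 2 * h + 1 - e, hs0, hs, by omega, by omega, ?_, ?_⟩
    · rw [if_neg (by omega), hx]
      exact (rrIntNode_eq_iff _ _ _).2 (Int.modEq_iff_dvd.2 ⟨-1, by ring⟩)
    · rw [hy]
      exact (rrIntNode_eq_iff _ _ _).2 (Int.modEq_iff_dvd.2 ⟨1, by ring⟩)

theorem rrGraph_adj_one {m h : ℕ} (hm : m < 2 * h + 1) {x : ℤ} (hx0 : 0 ≤ x) (hx : x ≤ m) :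
    (rrGraph (m + 1) (2 * h + 2)).Adj 1 (rrIntNode h x) := by
  rw [rrGraph, SimpleGraph.fromRel_adj, rrRel_iff m h hm]
  exact ⟨(rrIntNode_ne_one h x).symm,
    Or.inl ⟨x, 0, hx0, hx, le_rfl, by omega, by simp, by simp⟩⟩

theorem rrGraph_adj_cases {m h : ℕ} (hm : m < 2 * h + 1) {a b : ℕ}
    (hab : (rrGraph (m + 1) (2 * h + 2)).Adj a b) :
    ∃ s : ℤ, 0 ≤ s ∧ s ≤ m ∧ ((a = 1 ∧ b = rrIntNode h s) ∨ (b = 1 ∧ a = rrIntNode h s) ∨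
      ∃ k : ℤ, 1 ≤ k ∧ k ≤ h ∧ ((a = rrIntNode h (s - k) ∧ b = rrIntNode h (s + k)) ∨
        (b = rrIntNode h (s - k) ∧ a = rrIntNode h (s + k)))) := by
  rw [rrGraph, SimpleGraph.fromRel_adj, rrRel_iff m h hm, rrRel_iff m h hm] at hab
  obtain ⟨-, ⟨s, k, hs0, hs, hk0, hk, ha, hb⟩ | ⟨s, k, hs0, hs, hk0, hk, hb, ha⟩⟩ := hab
  all_goals
    refine ⟨s, hs0, hs, ?_⟩
    by_cases h0 : k = 0
    · subst h0
      simp only [if_true, add_zero] at ha hb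
      tauto
    · rw [if_neg h0] at *
      exact Or.inr (Or.inr ⟨k, by omega, hk, by tauto⟩)

theorem rrBall_mono {m h r : ℕ} {v : ℕ} (hv : rrBall m h r v) : rrBall m h (r + 1) v := by
  obtain rfl | ⟨x, h₁, h₂, rfl⟩ := hv
  · exact Or.inl rfl
  · refine Or.inr ⟨x, ?_, ?_, rfl⟩ <;> push_cast <;> linarith

theorem rrBall_of_adj {m h r : ℕ} (hm : m < 2 * h + 1) {u v : ℕ}
    (huv : (rrGraph (m + 1) (2 * h + 2)).Adj u v) (hu : rrBall m h r u) :
    rrBall m h (r + 1) v := by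
  have hrm : (0 : ℤ) ≤ (r : ℤ) * m := by positivity
  obtain ⟨s, hs0, hs, ⟨rfl, rfl⟩ | ⟨rfl, rfl⟩ | ⟨k, hk0, hk, hk'⟩⟩ := rrGraph_adj_cases hm huv
  · refine Or.inr ⟨s, ?_, ?_, rfl⟩ <;> push_cast <;> linarith
  · exact Or.inl rfl
  · rcases hu with rfl | ⟨x, h₁, h₂, rfl⟩
    · rcases hk' with hk' | hk'
      · exact absurd hk'.1.symm (rrIntNode_ne_one _ _)
      · exact absurd hk'.2.symm (rrIntNode_ne_one _ _)
    · refine Or.inr ⟨2 * s - x, ?_, ?_, ?_⟩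
      · push_cast; linarith
      · push_cast; linarith
      · rcases hk' with ⟨ha, rfl⟩ | ⟨rfl, ha⟩
        all_goals
          rw [rrIntNode_eq_iff] at ha ⊢
          obtain ⟨c, hc⟩ := ha.dvd
          exact Int.modEq_iff_dvd.2 ⟨c, by linarith⟩

theorem rrBall_of_walk {m h : ℕ} (hm : m < 2 * h + 1) {u v : ℕ}
    (p : (rrGraph (m + 1) (2 * h + 2)).Walk u v) {r : ℕ} (hu : rrBall m h r u) :
    rrBall m h (r + p.length) v := by
  induction p generalizing r with
  | nil => exact hu
  | cons hadj p ih =>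
    have := ih (rrBall_of_adj hm hadj hu)
    rwa [SimpleGraph.Walk.length_cons, add_comm p.length, ← add_assoc]

theorem exists_walk_of_rrBall {m h : ℕ} (hm : m < 2 * h + 1) (r : ℕ) {v : ℕ}
    (hv : rrBall m h (r + 1) v) :
    ∃ p : (rrGraph (m + 1) (2 * h + 2)).Walk 1 v, p.length ≤ r + 1 := by
  induction r generalizing v with
  | zero =>
    obtain rfl | ⟨x, h₁, h₂, rfl⟩ := hv
    · exact ⟨.nil, by simp⟩
    · push_cast at h₁ h₂
      exact ⟨(rrGraph_adj_one hm (by linarith) (by linarith)).toWalk, by simp⟩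
  | succ r ih =>
    obtain rfl | ⟨y, h₁, h₂, rfl⟩ := hv
    · exact ⟨.nil, by simp⟩
    have hrm : (0 : ℤ) ≤ (r : ℤ) * m := by positivity
    push_cast at h₁ h₂
    obtain ⟨x, s, hs0, hs, hxy, hx⟩ : ∃ x s : ℤ, 0 ≤ s ∧ s ≤ m ∧ x + y = 2 * s ∧
        -(((r + 1 : ℕ) : ℤ) * m) + m ≤ x ∧ x ≤ ((r + 1 : ℕ) : ℤ) * m := by
      push_cast
      rcases le_or_gt y 0 with hy | hy
      · exact ⟨-y, 0, le_rfl, by omega, by ring, by linarith, by linarith⟩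
      · rcases le_or_gt y m with hym | hym
        · exact ⟨y, y, by omega, by omega, by ring, by linarith, by linarith⟩
        · exact ⟨2 * m - y, m, by omega, le_rfl, by ring, by linarith, by linarith⟩
    have hball : rrBall m h (r + 1) (rrIntNode h x) := Or.inr ⟨x, hx.1, hx.2, rfl⟩
    obtain ⟨p, hp⟩ := ih hball
    by_cases hne : rrIntNode h x = rrIntNode h y
    · rw [← hne]
      exact ⟨p, by omega⟩
    · exact ⟨p.concat (rrGraph_adj_rrIntNode hm hs0 hs hxy hne), by simpa using hp⟩

theorem rrGraph_dist_eq_iff {m h : ℕ} (hm : m < 2 * h + 1) (r v : ℕ) :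
    (rrGraph (m + 1) (2 * h + 2)).dist 1 v = r + 2 ↔
      rrBall m h (r + 2) v ∧ ¬ rrBall m h (r + 1) v := by
  have hle : ∀ p : (rrGraph (m + 1) (2 * h + 2)).Walk 1 v, ∀ r, p.length ≤ r →
      rrBall m h r v := by
    intro p r hp
    have h0 := rrBall_of_walk hm p (r := r - p.length) (Or.inl rfl)
    rwa [Nat.sub_add_cancel hp] at h0
  constructor
  · intro hd
    have hreach : (rrGraph (m + 1) (2 * h + 2)).Reachable 1 v :=
      SimpleGraph.Reachable.of_dist_ne_zero (by omega)
    obtain ⟨p, hp⟩ := hreach.exists_walk_length_eq_dist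
    refine ⟨hle p _ (by omega), fun hb => ?_⟩
    obtain ⟨p', hp'⟩ := exists_walk_of_rrBall hm r hb
    have := SimpleGraph.dist_le p'
    omega
  · rintro ⟨h₁, h₂⟩
    obtain ⟨p, hp⟩ := exists_walk_of_rrBall hm (r + 1) h₁
    have hdle := SimpleGraph.dist_le p
    obtain ⟨p', hp'⟩ := p.reachable.exists_walk_length_eq_dist
    by_contra hne
    exact h₂ (hle p' _ (by omega))

theorem rrGraph_layer_iff {m h q : ℕ} (hm : m < 2 * h + 1) (hq : 2 ≤ q) {a b : ℕ}
    (hab : (rrGraph (m + 1) (2 * h + 2)).Adj a b) :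
    (((rrGraph (m + 1) (2 * h + 2)).dist 1 a = q ∧
        (rrGraph (m + 1) (2 * h + 2)).dist 1 b = q + 1) ∨
      ((rrGraph (m + 1) (2 * h + 2)).dist 1 a = q + 1 ∧
        (rrGraph (m + 1) (2 * h + 2)).dist 1 b = q) ∨
      ((rrGraph (m + 1) (2 * h + 2)).dist 1 a = q + 1 ∧
        (rrGraph (m + 1) (2 * h + 2)).dist 1 b = q + 1)) ↔
    rrBall m h (q + 1) a ∧ rrBall m h (q + 1) b ∧ ¬ (rrBall m h q a ∧ rrBall m h q b) := by
  obtain ⟨r, rfl⟩ : ∃ r, q = r + 2 := ⟨q - 2, by omega⟩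
  have ha := rrGraph_dist_eq_iff hm r a
  have hb := rrGraph_dist_eq_iff hm r b
  have ha' := rrGraph_dist_eq_iff hm (r + 1) a
  have hb' := rrGraph_dist_eq_iff hm (r + 1) b
  simp only [show r + 1 + 2 = r + 2 + 1 by ring, show r + 1 + 1 = r + 2 by ring] at ha' hb'
  rw [ha, hb, ha', hb']
  have h₁ : rrBall m h (r + 1) a → rrBall m h (r + 2) b := rrBall_of_adj hm hab
  have h₂ : rrBall m h (r + 1) b → rrBall m h (r + 2) a := rrBall_of_adj hm hab.symm
  have h₃ : rrBall m h (r + 2) a → rrBall m h (r + 2 + 1) a := rrBall_mono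
  have h₄ : rrBall m h (r + 2) b → rrBall m h (r + 2 + 1) b := rrBall_mono
  generalize rrBall m h (r + 1) a = a₁ at *
  generalize rrBall m h (r + 1) b = b₁ at *
  generalize rrBall m h (r + 2) a = a₂ at *
  generalize rrBall m h (r + 2) b = b₂ at *
  generalize rrBall m h (r + 2 + 1) a = a₃ at *
  generalize rrBall m h (r + 2 + 1) b = b₃ at *
  clear ha hb ha' hb' hab
  by_cases a₂ <;> by_cases b₂ <;> simp_all

theorem rrBall_rrIntNode_iff {m h r : ℕ} {x : ℤ} (h₁ : x + r * m ≤ 2 * h + m)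
    (h₂ : r * m - x ≤ 2 * h) :
    rrBall m h r (rrIntNode h x) ↔ -((r : ℤ) * m) + m ≤ x ∧ x ≤ r * m := by
  constructor
  · rintro (h0 | ⟨y, hy₁, hy₂, hxy⟩)
    · exact absurd h0 (rrIntNode_ne_one _ _)
    · have := eq_of_rrIntNode_eq hxy (by linarith) (by linarith)
      subst this
      exact ⟨hy₁, hy₂⟩
  · rintro ⟨hx₁, hx₂⟩
    exact Or.inr ⟨x, hx₁, hx₂, rfl⟩

/-- Chord `k` around `s` lies in the ball of radius `q + 1` but not in that of radius `q`
exactly when `k` lies in an interval of length `m`. -/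
theorem rrBall_chord_iff {m h q : ℕ} (hqm : (q + 1) * m ≤ h) {s k : ℤ} (hs0 : 0 ≤ s)
    (hs : s ≤ m) (hk0 : 1 ≤ k) (hk : k ≤ h) :
    (rrBall m h (q + 1) (rrIntNode h (s - k)) ∧ rrBall m h (q + 1) (rrIntNode h (s + k)) ∧
      ¬ (rrBall m h q (rrIntNode h (s - k)) ∧ rrBall m h q (rrIntNode h (s + k)))) ↔
    min (q * m - s) (q * m - m + s) < k ∧ k ≤ min (q * m - s) (q * m - m + s) + m := by
  have hqm' : (q : ℤ) * m + m ≤ h := by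
    have : (((q + 1) * m : ℕ) : ℤ) ≤ h := by exact_mod_cast hqm
    push_cast at this
    linarith
  have hW : (0 : ℤ) ≤ (q : ℤ) * m := by positivity
  rw [rrBall_rrIntNode_iff (by push_cast; linarith) (by push_cast; linarith),
    rrBall_rrIntNode_iff (by push_cast; linarith) (by push_cast; linarith),
    rrBall_rrIntNode_iff (by linarith) (by linarith),
    rrBall_rrIntNode_iff (by linarith) (by linarith)]
  push_cast
  rw [add_mul, one_mul]
  generalize (q : ℤ) * m = W at *
  omega

theorem min_max_eq_cases {a b c d : ℕ} (h : (min a b, max a b) = (min c d, max c d)) :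
    (a = c ∧ b = d) ∨ (a = d ∧ b = c) := by
  rw [Prod.mk.injEq] at h
  omega

theorem rrIntNode_chord_inj {m h : ℕ} (hm : m ≤ h) {s k s' k' : ℤ} (hs0 : 0 ≤ s) (hs : s ≤ m)
    (hk0 : 1 ≤ k) (hk : k ≤ h) (hs0' : 0 ≤ s') (hs' : s' ≤ m) (hk0' : 1 ≤ k') (hk' : k' ≤ h)
    (heq : (rrIntNode h (s - k) = rrIntNode h (s' - k') ∧
        rrIntNode h (s + k) = rrIntNode h (s' + k')) ∨
      (rrIntNode h (s - k) = rrIntNode h (s' + k') ∧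
        rrIntNode h (s + k) = rrIntNode h (s' - k'))) :
    s = s' ∧ k = k' := by
  have hss : s = s' := by
    have hmod : (s - k) + (s + k) ≡ (s' - k') + (s' + k') [ZMOD (2 * h + 1)] := by
      simp only [rrIntNode_eq_iff] at heq
      rcases heq with ⟨h₁, h₂⟩ | ⟨h₁, h₂⟩
      · exact h₁.add h₂
      · rw [add_comm (s' - k')]
        exact h₁.add h₂
    have := eq_of_rrIntNode_eq ((rrIntNode_eq_iff h _ _).2 hmod) (by omega) (by omega)
    omega
  subst hss
  rcases heq with ⟨-, h₂⟩ | ⟨-, h₂⟩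
  · have := eq_of_rrIntNode_eq h₂ (by omega) (by omega)
    omega
  · have := eq_of_rrIntNode_eq h₂ (by omega) (by omega)
    omega

open scoped Classical in
theorem rr_edge_layer_card (n N : ℕ) (hN : Even N) (hn : 2 ≤ n) (hnN : 4 * n < N) :
    ∀ q, 2 ≤ q → q ≤ (N / 2 - 1) / (n - 1) - 1 →
      (((Finset.Icc 1 N) ×ˢ (Finset.Icc 1 N)).filter fun p : ℕ × ℕ =>
        p.1 < p.2 ∧ (rrGraph n N).Adj p.1 p.2 ∧
          (((rrGraph n N).dist 1 p.1 = q ∧ (rrGraph n N).dist 1 p.2 = q + 1) ∨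
           ((rrGraph n N).dist 1 p.1 = q + 1 ∧ (rrGraph n N).dist 1 p.2 = q) ∨
           ((rrGraph n N).dist 1 p.1 = q + 1 ∧ (rrGraph n N).dist 1 p.2 = q + 1))).card
        = n * (n - 1) := by
  intro q hq hqQ
  obtain ⟨m, rfl⟩ : ∃ m, n = m + 1 := ⟨n - 1, by omega⟩
  obtain ⟨h, rfl⟩ : ∃ h, N = 2 * h + 2 := by
    obtain ⟨c, hc⟩ := hN
    exact ⟨c - 1, by omega⟩
  have hqm : (q + 1) * m ≤ h := by
    rw [show (2 * h + 2) / 2 - 1 = h by omega, Nat.add_sub_cancel] at hqQ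
    exact (Nat.le_div_iff_mul_le (by omega)).1 (by omega)
  have hmh : m ≤ h := by omega
  have hm : m < 2 * h + 1 := by omega
  have hqm' : (q : ℤ) * m + m ≤ h := by
    have : (((q + 1) * m : ℕ) : ℤ) ≤ h := by exact_mod_cast hqm
    push_cast at this
    linarith
  have hqm2 : 2 * (m : ℤ) ≤ q * m := by
    have : (2 : ℤ) ≤ q := by exact_mod_cast hq
    nlinarith
  let A : ℤ → ℤ := fun s => min (q * m - s) (q * m - m + s)
  have hA : ∀ s : ℤ, 0 ≤ s → s ≤ m → 0 ≤ A s ∧ A s + m ≤ h := by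
    intro s hs0 hs
    simp only [A]
    generalize (q : ℤ) * m = W at *
    omega
  let f : ℤ × ℤ → ℕ × ℕ := fun z =>
    (min (rrIntNode h (z.1 - (A z.1 + z.2))) (rrIntNode h (z.1 + (A z.1 + z.2))),
      max (rrIntNode h (z.1 - (A z.1 + z.2))) (rrIntNode h (z.1 + (A z.1 + z.2))))
  have hcard : (Finset.Icc (0 : ℤ) m ×ˢ Finset.Icc (1 : ℤ) m).card
      = (m + 1) * (m + 1 - 1) := by
    rw [Finset.card_product, Int.card_Icc, Int.card_Icc]
    congr 1
    omega
  rw [← hcard]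
  symm
  refine Finset.card_nbij f ?_ ?_ ?_
  · rintro ⟨s, i⟩ hz
    simp only [Finset.coe_product, Finset.coe_Icc, Set.mem_prod, Set.mem_Icc] at hz
    obtain ⟨⟨hs0, hs⟩, hi0, hi⟩ := hz
    obtain ⟨hA0, hA1⟩ := hA s hs0 hs
    have hk := (rrBall_chord_iff hqm hs0 hs (k := A s + i) (by omega) (by omega)).2
      ⟨by simp only [A]; omega, by simp only [A]; omega⟩
    have hne : rrIntNode h (s - (A s + i)) ≠ rrIntNode h (s + (A s + i)) := by
      intro heq
      have := eq_of_rrIntNode_eq heq (by omega) (by omega)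
      omega
    have hadj := rrGraph_adj_rrIntNode hm hs0 hs (by ring) hne
    have h₁ := rrIntNode_mem_Icc h (s - (A s + i))
    have h₂ := rrIntNode_mem_Icc h (s + (A s + i))
    simp only [Finset.coe_filter, Set.mem_ofPred_eq, Finset.mem_product,
      Finset.mem_Icc, f]
    rcases lt_or_gt_of_ne hne with hlt | hlt
    · rw [min_eq_left hlt.le, max_eq_right hlt.le]
      exact ⟨by omega, hlt, hadj, (rrGraph_layer_iff hm hq hadj).2 hk⟩
    · rw [min_eq_right hlt.le, max_eq_left hlt.le]
      exact ⟨by omega, hlt, hadj.symm, (rrGraph_layer_iff hm hq hadj.symm).2 (by tauto)⟩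
  · rintro ⟨s, i⟩ hz ⟨s', i'⟩ hz' heq
    simp only [Finset.coe_product, Finset.coe_Icc, Set.mem_prod, Set.mem_Icc] at hz hz'
    obtain ⟨⟨hs0, hs⟩, hi0, hi⟩ := hz
    obtain ⟨⟨hs0', hs'⟩, hi0', hi'⟩ := hz'
    obtain ⟨hA0, hA1⟩ := hA s hs0 hs
    obtain ⟨hA0', hA1'⟩ := hA s' hs0' hs'
    obtain ⟨rfl, hk⟩ := rrIntNode_chord_inj (k := A s + i) (k' := A s' + i') hmh hs0 hs
      (by omega) (by omega) hs0' hs'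
      (by omega) (by omega) (min_max_eq_cases heq)
    rw [Prod.mk.injEq]
    exact ⟨rfl, by omega⟩
  · rintro ⟨a, b⟩ hp
    simp only [Finset.coe_filter, Set.mem_ofPred_eq] at hp
    obtain ⟨-, hlt, hadj, hlayer⟩ := hp
    rw [rrGraph_layer_iff hm hq hadj] at hlayer
    have hsmall : ∀ s : ℤ, 0 ≤ s → s ≤ m → rrBall m h q (rrIntNode h s) := fun s hs0 hs =>
      Or.inr ⟨s, by linarith, by linarith, rfl⟩
    obtain ⟨s, hs0, hs, ⟨rfl, rfl⟩ | ⟨rfl, rfl⟩ | ⟨k, hk0, hk, hab⟩⟩ :=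
      rrGraph_adj_cases hm hadj
    · exact absurd ⟨Or.inl rfl, hsmall s hs0 hs⟩ hlayer.2.2
    · exact absurd ⟨hsmall s hs0 hs, Or.inl rfl⟩ hlayer.2.2
    · have hrange : A s < k ∧ k ≤ A s + m := by
        refine (rrBall_chord_iff hqm hs0 hs hk0 hk).1 ?_
        rcases hab with ⟨rfl, rfl⟩ | ⟨rfl, rfl⟩ <;> tauto
      refine ⟨(s, k - A s), ?_, ?_⟩
      · simp only [Finset.coe_product, Finset.coe_Icc, Set.mem_prod, Set.mem_Icc]
        omega
      · simp only [f, add_sub_cancel]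
        rcases hab with ⟨rfl, rfl⟩ | ⟨rfl, rfl⟩
        · rw [min_eq_left hlt.le, max_eq_right hlt.le]
        · rw [min_eq_right hlt.le, max_eq_left hlt.le]
end
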